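/- Let k be a positive integer and let T be an antidirected tree with k arcs. Let u, v be distinct vertices of T such that u is an out-vertex with deg⁺(u) = Δ(T) and v is an in-vertex with deg⁻(v) = Δ₂(T) ≥ ⌊k/4⌋ + 3. Suppose Δ(T) + Δ₂(T) < 7k/12 and |B_uv(T)| ≤ k + 1 − (Δ(T) − Δ₂(T)). Then for every digraph D' with a(D') > (k−1)·(|(D')⁺| + |(D')⁻|)/2, the double broom B_uv(T) embeds in D'. -/

import Mathlib

open Finset

section Defs

variable {V W : Type*}

/-- Number of arcs of a digraph given by a Boolean adjacency relation. -/
def arcCount [Fintype V] (A : V → V → Bool) : ℕ :=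
  ((univ : Finset (V × V)).filter (fun p => A p.1 p.2)).card

/-- Out-neighbourhood. -/
def outNbr [Fintype V] (A : V → V → Bool) (a : V) : Finset V :=
  univ.filter (fun v => A a v)

/-- In-neighbourhood. -/
def inNbr [Fintype V] (A : V → V → Bool) (a : V) : Finset V :=
  univ.filter (fun v => A v a)

/-- Neighbourhood with a sign: `true` = out, `false` = in. -/
def nbr [Fintype V] (A : V → V → Bool) (sign : Bool) (a : V) : Finset V :=
  if sign then outNbr A a else inNbr A a

/-- Total degree (out-degree plus in-degree). -/
def totalDeg [Fintype V] (A : V → V → Bool) (a : V) : ℕ :=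
  (outNbr A a).card + (inNbr A a).card

/-- Maximum total degree `Δ`. -/
def maxDeg [Fintype V] (A : V → V → Bool) : ℕ :=
  univ.sup (totalDeg A)

/-- Second largest element `Δ₂` of the multiset of total degrees. -/
def secondMaxDeg [Fintype V] (A : V → V → Bool) : ℕ :=
  (((univ : Finset V).val.map (totalDeg A)).erase (maxDeg A)).sup

/-- Loopless digraph. -/
def Loopless (A : V → V → Bool) : Prop := ∀ v, ¬ A v v

/-- Antidirected digraph: no directed path with two arcs. -/
def Antidirected (A : V → V → Bool) : Prop := ∀ x y z, A x y → A y z → False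

/-- The underlying (undirected) simple graph of a digraph. -/
def underG (A : V → V → Bool) : SimpleGraph V :=
  SimpleGraph.fromRel (fun x y => A x y)

/-- `𝒦_{2,s}`-freeness: no two distinct vertices `a`, `b` together with signs and `s`
distinct vertices (all different from `a` and `b`) lying in both signed neighbourhoods. -/
def K2sFree [Fintype V] [DecidableEq V] (A : V → V → Bool) (s : ℕ) : Prop :=
  ¬ ∃ (a b : V) (sa sb : Bool) (S : Finset V), a ≠ b ∧ S.card = s ∧
      a ∉ S ∧ b ∉ S ∧ S ⊆ nbr A sa a ∩ nbr A sb b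

/-- `T` embeds in `A`: there is an injective arc-preserving map. -/
def Embeds (T : W → W → Bool) (A : V → V → Bool) : Prop :=
  ∃ f : W → V, Function.Injective f ∧ ∀ x y, T x y → A (f x) (f y)

/-- Vertices of positive out-degree. -/
def outVerts [Fintype V] (A : V → V → Bool) : Finset V :=
  univ.filter (fun v => (outNbr A v).card ≠ 0)

/-- Vertices of positive in-degree. -/
def inVerts [Fintype V] (A : V → V → Bool) : Finset V :=
  univ.filter (fun v => (inNbr A v).card ≠ 0)

/-- A caterpillar: a tree with a path such that every vertex is on the path
or adjacent to it. -/
def IsCaterpillarG {X : Type*} (G : SimpleGraph X) : Prop :=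
  G.IsTree ∧ ∃ (x y : X) (P : G.Walk x y), P.IsPath ∧
    ∀ v, v ∈ P.support ∨ ∃ w ∈ P.support, G.Adj v w

/-- Minimum pseudo-semidegree at least `m`: at least one arc, and every
out-degree and in-degree is `0` or at least `m`. -/
def MinPseudoSemidegGe [Fintype V] (A : V → V → Bool) (m : ℕ) : Prop :=
  0 < arcCount A ∧ (∀ v, (outNbr A v).card = 0 ∨ m ≤ (outNbr A v).card) ∧
    (∀ v, (inNbr A v).card = 0 ∨ m ≤ (inNbr A v).card)

/-- `D'` is a subdigraph of `D` with vertex set `S`. -/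
def SubdigraphOn (D : V → V → Bool) (S : Finset V) (D' : V → V → Bool) : Prop :=
  ∀ x y, D' x y → D x y ∧ x ∈ S ∧ y ∈ S

/-- The vertex set of the double broom `B_{uv}(T)`: the path joining `u` and `v`
together with all neighbours of `u` and all neighbours of `v`. -/
def broomSet [Fintype W] [DecidableEq W] (T : W → W → Bool) {u v : W}
    (p : (underG T).Walk u v) : Finset W :=
  p.support.toFinset ∪ (outNbr T u ∪ inNbr T u) ∪ (outNbr T v ∪ inNbr T v)

/-- `z` lies strictly after `x` and strictly before `y` in clockwise (cyclic) order
on `Fin n`. -/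
def cycBetween {n : ℕ} (x y z : Fin n) : Prop :=
  if x < y then x < z ∧ z < y else x < z ∨ z < y

/-- An arc `pq` of the convex digraph `A` on `Fin n` is good for the antidirected
caterpillar `T` with final vertex `u`, its spine neighbour `v`, and spine with
`plen` edges (so `plen + 1` spine vertices). -/
def GoodArc {n : ℕ} (A : Fin n → Fin n → Bool) (T : W → W → Bool)
    (u v : W) (plen : ℕ) (pq : Fin n × Fin n) : Prop :=
  ∃ f : W → Fin n, Function.Injective f ∧ (∀ x y, T x y → A (f x) (f y)) ∧
    ((T v u = true ∧ (f v, f u) = pq) ∨ (T u v = true ∧ (f u, f v) = pq)) ∧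
    (∀ z : Fin n,
      (plen % 2 = 0 → cycBetween (f u) (f v) z → z ∉ Set.range f) ∧
      (plen % 2 = 1 → z ≠ f u → z ≠ f v → ¬ cycBetween (f u) (f v) z →
        z ∉ Set.range f))

/-- Number of edges of a bipartite graph with parts `α`, `β`. -/
def bipArcCount {α β : Type*} [Fintype α] [Fintype β] (E : α → β → Bool) : ℕ :=
  ((univ : Finset (α × β)).filter (fun p => E p.1 p.2)).card

/-- Degree of a vertex of the `α` part. -/
def bipDegA {α β : Type*} [Fintype β] (E : α → β → Bool) (a : α) : ℕ :=
  (univ.filter (fun b => E a b)).card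

/-- Degree of a vertex of the `β` part. -/
def bipDegB {α β : Type*} [Fintype α] (E : α → β → Bool) (b : β) : ℕ :=
  (univ.filter (fun a => E a b)).card

end Defs

section Tree

variable {X : Type*} {G : SimpleGraph X}

theorem SimpleGraph.IsTree.length_eq_dist (hG : G.IsTree) {a b : X} {q : G.Walk a b}
    (hq : q.IsPath) : q.length = G.dist a b := by
  obtain ⟨r, hr, hrl⟩ := hG.connected.exists_path_of_dist a b
  rw [(hG.existsUnique_path a b).unique hq hr, hrl]

theorem SimpleGraph.IsTree.dist_getVert (hG : G.IsTree) {a b : X} {q : G.Walk a b}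
    (hq : q.IsPath) {m : ℕ} (hm : m ≤ q.length) : G.dist a (q.getVert m) = m := by
  rw [← hG.length_eq_dist (hq.take m), SimpleGraph.Walk.take_length, min_eq_left hm]

/-- In a rooted tree every vertex has at most one neighbour closer to the root. -/
theorem SimpleGraph.IsTree.parent_unique (hG : G.IsTree) {r a b w : X}
    (ha : G.Adj a w) (hb : G.Adj b w) (hda : G.dist r a + 1 = G.dist r w)
    (hdb : G.dist r b + 1 = G.dist r w) : a = b := by
  obtain ⟨q, -, hql⟩ := hG.connected.exists_path_of_dist r a
  obtain ⟨q', -, hql'⟩ := hG.connected.exists_path_of_dist r b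
  have h1 : (q.concat ha).IsPath := (q.concat ha).isPath_of_length_eq_dist (by
    rw [SimpleGraph.Walk.length_concat, hql, hda])
  have h2 : (q'.concat hb).IsPath := (q'.concat hb).isPath_of_length_eq_dist (by
    rw [SimpleGraph.Walk.length_concat, hql', hdb])
  have h := (hG.existsUnique_path r w).unique h1 h2
  rw [← q.penultimate_concat ha, h, q'.penultimate_concat hb]

/-- If `s` is a neighbour of `w` closer to the root than `w`, then it is the only neighbour of `w`
no farther from the root than `s`. -/
theorem SimpleGraph.IsTree.eq_of_adj_of_dist_le (hG : G.IsTree) {r s w x : X}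
    (hs : G.Adj s w) (hds : G.dist r s + 1 = G.dist r w) (hx : G.Adj x w)
    (hdx : G.dist r x ≤ G.dist r w) : x = s := by
  refine hG.parent_unique hx hs ?_ hds
  rcases hG.dist_eq_dist_add_one_of_adj r hx with h | h <;> omega

end Tree

section Cyclic

variable {V : Type*}

/-- Clockwise distance from `p` to `q` when the vertices are placed on a cycle of length `n` at the
positions given by `e`. -/
def cycDist (n : ℕ) (e : V → ℕ) (p q : V) : ℕ :=
  if e p ≤ e q then e q - e p else n + e q - e p

/-- `x` lies on the closed clockwise interval from `p` to `q`. -/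
def InArc (n : ℕ) (e : V → ℕ) (p x q : V) : Prop :=
  cycDist n e p x + cycDist n e x q = cycDist n e p q

variable {n : ℕ} {e : V → ℕ}

theorem inArc_left (p q : V) : InArc n e p p q := by simp [InArc, cycDist]

theorem inArc_right (p q : V) : InArc n e p q q := by simp [InArc, cycDist]

theorem InArc.extend_right (he : ∀ x, e x < n) {p x q q' : V} (h : InArc n e p x q)
    (hlt : cycDist n e p q < cycDist n e p q') : InArc n e p x q' ∧ x ≠ q' := by
  have h1 := he p; have h2 := he q; have h3 := he q'; have h4 := he x
  constructor
  · unfold InArc cycDist at *; split_ifs at * <;> omega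
  · rintro rfl
    unfold InArc cycDist at *; split_ifs at * <;> omega

theorem InArc.extend_left (he : ∀ x, e x < n) {p p' x q : V} (h : InArc n e p x q)
    (hlt : cycDist n e p q < cycDist n e p' q) : InArc n e p' x q ∧ x ≠ p' := by
  have h1 := he p; have h2 := he q; have h3 := he p'; have h4 := he x
  constructor
  · unfold InArc cycDist at *; split_ifs at * <;> omega
  · rintro rfl
    unfold InArc cycDist at *; split_ifs at * <;> omega

theorem cycDist_right_injective (he : ∀ x, e x < n) (hinj : Function.Injective e) (p : V) :
    Function.Injective (cycDist n e p) := by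
  intro q q' h
  have h1 := he p; have h2 := he q; have h3 := he q'
  apply hinj
  unfold cycDist at h; split_ifs at h <;> omega

theorem cycDist_left_injective (he : ∀ x, e x < n) (hinj : Function.Injective e) (q : V) :
    Function.Injective (fun p => cycDist n e p q) := by
  intro p p' h
  have h1 := he p; have h2 := he q; have h3 := he p'
  apply hinj
  simp only [cycDist] at h; split_ifs at h <;> omega

end Cyclic

section Zigzag

variable {V W : Type*}

open Classical in
/-- The arcs of `D` that are the image of `st` under an embedding of the subdigraph of `T` on `S`
into a clockwise interval bounded by the ends of the arc. -/
noncomputable def goodArcs [Fintype V] (D : V → V → Bool) (n : ℕ) (e : V → ℕ) (T : W → W → Bool)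
    (S : Finset W) (s t : W) : Finset (V × V) :=
  univ.filter fun pq => D pq.1 pq.2 ∧ ∃ f : W → V, Set.InjOn f S ∧
    (∀ x ∈ S, ∀ y ∈ S, T x y → D (f x) (f y)) ∧ f s = pq.1 ∧ f t = pq.2 ∧
    ∀ x ∈ S, InArc n e pq.1 (f x) pq.2

theorem mem_goodArcs [Fintype V] {D : V → V → Bool} {n : ℕ} {e : V → ℕ} {T : W → W → Bool}
    {S : Finset W} {s t : W} {p q : V} : (p, q) ∈ goodArcs D n e T S s t ↔
    D p q ∧ ∃ f : W → V, Set.InjOn f S ∧ (∀ x ∈ S, ∀ y ∈ S, T x y → D (f x) (f y)) ∧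
      f s = p ∧ f t = q ∧ ∀ x ∈ S, InArc n e p (f x) q := by
  simp [goodArcs]

variable [DecidableEq W]

theorem injOn_update_insert {S : Finset W} {f : W → V} (hf : Set.InjOn f S) {w : W}
    (hw : w ∉ S) {a : V} (ha : ∀ x ∈ S, f x ≠ a) : Set.InjOn (Function.update f w a) ↑(insert w S) := by
  intro x hx y hy hxy
  rw [mem_coe, mem_insert] at hx hy
  rcases hx with rfl | hx <;> rcases hy with rfl | hy
  · rfl
  · have hne : y ≠ x := fun h => hw (h ▸ hy)
    rw [Function.update_self, Function.update_of_ne hne] at hxy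
    exact (ha y hy hxy.symm).elim
  · have hne : x ≠ y := fun h => hw (h ▸ hx)
    rw [Function.update_self, Function.update_of_ne hne] at hxy
    exact (ha x hx hxy).elim
  · have hnx : x ≠ w := fun h => hw (h ▸ hx)
    have hny : y ≠ w := fun h => hw (h ▸ hy)
    rw [Function.update_of_ne hnx, Function.update_of_ne hny] at hxy
    exact hf hx hy hxy

/-- `Zigzag T S s t i j`: the subdigraph of `T` on `S` is built from a single arc by adding pendant
vertices one at a time, each attached to one of the two ends of the arc added just before. The last
arc is `st`; in total `i` vertices were attached to a tail and `j` to a head. -/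
inductive Zigzag (T : W → W → Bool) : Finset W → W → W → ℕ → ℕ → Prop
  | single {s t : W} : T s t → Zigzag T {s, t} s t 0 0
  | addHead {S : Finset W} {s t w : W} {i j : ℕ} : Zigzag T S s t i j → w ∉ S → T s w →
      (∀ x ∈ S, T x w → x = s) → Zigzag T (insert w S) s w (i + 1) j
  | addTail {S : Finset W} {s t w : W} {i j : ℕ} : Zigzag T S s t i j → w ∉ S → T w t →
      (∀ x ∈ S, T w x → x = t) → Zigzag T (insert w S) w t i (j + 1)

variable {T : W → W → Bool} {S L : Finset W} {s t : W} {i j : ℕ}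

theorem Zigzag.ends_mem (h : Zigzag T S s t i j) : s ∈ S ∧ t ∈ S := by
  induction h with
  | single _ => simp
  | addHead _ _ _ _ ih => simp [ih.1]
  | addTail _ _ _ _ ih => simp [ih.2]

theorem Zigzag.card_eq (hT : Antidirected T) (h : Zigzag T S s t i j) : S.card = i + j + 2 := by
  induction h with
  | single h =>
    rw [card_pair]
    rintro rfl
    exact hT _ _ _ h h
  | addHead _ hw _ _ ih => rw [card_insert_of_notMem hw, ih]; ring
  | addTail _ hw _ _ ih => rw [card_insert_of_notMem hw, ih]; ring

theorem Zigzag.addHeads (hT : Antidirected T) (h : Zigzag T S s t i j) (hd : Disjoint L S)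
    (hL : ∀ w ∈ L, T s w ∧ ∀ x ∈ S, T x w → x = s) :
    ∃ t', Zigzag T (L ∪ S) s t' (i + L.card) j := by
  induction L using Finset.induction_on with
  | empty => exact ⟨t, by simpa using h⟩
  | insert a L ha ih =>
    rw [disjoint_insert_left] at hd
    obtain ⟨t', ht'⟩ := ih hd.2 fun w hw => hL w (mem_insert_of_mem hw)
    have hLa := hL a (mem_insert_self a L)
    refine ⟨a, ?_⟩
    rw [insert_union, card_insert_of_notMem ha, ← add_assoc]
    refine ht'.addHead (by simp [ha, hd.1]) hLa.1 fun x hx hxa => ?_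
    rcases mem_union.1 hx with hx | hx
    · exact (hT _ _ _ (hL x (mem_insert_of_mem hx)).1 hxa).elim
    · exact hLa.2 x hx hxa

theorem Zigzag.addTails (hT : Antidirected T) (h : Zigzag T S s t i j) (hd : Disjoint L S)
    (hL : ∀ w ∈ L, T w t ∧ ∀ x ∈ S, T w x → x = t) :
    ∃ s', Zigzag T (L ∪ S) s' t i (j + L.card) := by
  induction L using Finset.induction_on with
  | empty => exact ⟨s, by simpa using h⟩
  | insert a L ha ih =>
    rw [disjoint_insert_left] at hd
    obtain ⟨s', hs'⟩ := ih hd.2 fun w hw => hL w (mem_insert_of_mem hw)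
    have hLa := hL a (mem_insert_self a L)
    refine ⟨a, ?_⟩
    rw [insert_union, card_insert_of_notMem ha, ← add_assoc]
    refine hs'.addTail (by simp [ha, hd.1]) hLa.1 fun x hx hxa => ?_
    rcases mem_union.1 hx with hx | hx
    · exact (hT _ _ _ hxa (hL x (mem_insert_of_mem hx)).1).elim
    · exact hLa.2 x hx hxa

variable [Fintype V] {D : V → V → Bool} {n : ℕ} {e : V → ℕ}

theorem mem_goodArcs_insert_head (hT : Antidirected T) (he : ∀ x, e x < n) {w : W} (hs : s ∈ S)
    (hw : w ∉ S) (hsw : T s w) (huniq : ∀ x ∈ S, T x w → x = s) {p q q' : V}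
    (hpq : (p, q) ∈ goodArcs D n e T S s t) (hD : D p q')
    (hlt : cycDist n e p q < cycDist n e p q') :
    (p, q') ∈ goodArcs D n e T (insert w S) s w := by
  obtain ⟨-, f, hinj, harc, rfl, rfl, hin⟩ := mem_goodArcs.1 hpq
  have hne : ∀ x ∈ S, x ≠ w := fun x hx h => hw (h ▸ hx)
  refine mem_goodArcs.2 ⟨hD, Function.update f w q',
    injOn_update_insert hinj hw fun x hx => ((hin x hx).extend_right he hlt).2, ?_,
    Function.update_of_ne (hne s hs) _ _, Function.update_self _ _ _, ?_⟩
  · intro x hx y hy hxy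
    rw [mem_insert] at hx hy
    rcases hx with rfl | hx
    · exact (hT _ _ _ hsw hxy).elim
    rw [Function.update_of_ne (hne x hx)]
    rcases hy with rfl | hy
    · rwa [Function.update_self, huniq x hx hxy]
    · rw [Function.update_of_ne (hne y hy)]
      exact harc x hx y hy hxy
  · intro x hx
    rcases mem_insert.1 hx with rfl | hx
    · rw [Function.update_self]
      exact inArc_right _ _
    · rw [Function.update_of_ne (hne x hx)]
      exact ((hin x hx).extend_right he hlt).1

theorem mem_goodArcs_insert_tail (hT : Antidirected T) (he : ∀ x, e x < n) {w : W} (ht : t ∈ S)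
    (hw : w ∉ S) (hwt : T w t) (huniq : ∀ x ∈ S, T w x → x = t) {p p' q : V}
    (hpq : (p, q) ∈ goodArcs D n e T S s t) (hD : D p' q)
    (hlt : cycDist n e p q < cycDist n e p' q) :
    (p', q) ∈ goodArcs D n e T (insert w S) w t := by
  obtain ⟨-, f, hinj, harc, rfl, rfl, hin⟩ := mem_goodArcs.1 hpq
  have hne : ∀ x ∈ S, x ≠ w := fun x hx h => hw (h ▸ hx)
  refine mem_goodArcs.2 ⟨hD, Function.update f w p',
    injOn_update_insert hinj hw fun x hx => ((hin x hx).extend_left he hlt).2, ?_,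
    Function.update_self _ _ _, Function.update_of_ne (hne t ht) _ _, ?_⟩
  · intro x hx y hy hxy
    rw [mem_insert] at hx hy
    rcases hy with rfl | hy
    · exact (hT _ _ _ hxy hwt).elim
    rw [Function.update_of_ne (hne y hy)]
    rcases hx with rfl | hx
    · rwa [Function.update_self, huniq y hy hxy]
    · rw [Function.update_of_ne (hne x hx)]
      exact harc x hx y hy hxy
  · intro x hx
    rcases mem_insert.1 hx with rfl | hx
    · rw [Function.update_self]
      exact inArc_left _ _
    · rw [Function.update_of_ne (hne x hx)]
      exact ((hin x hx).extend_left he hlt).1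

theorem card_goodArcs_le_insert_head (hT : Antidirected T) (he : ∀ x, e x < n)
    (hinj : Function.Injective e) {w : W} (hs : s ∈ S)
    (hw : w ∉ S) (hsw : T s w) (huniq : ∀ x ∈ S, T x w → x = s) :
    (goodArcs D n e T S s t).card ≤
      (goodArcs D n e T (insert w S) s w).card + (outVerts D).card := by
  classical
  have h : (goodArcs D n e T S s t \ goodArcs D n e T (insert w S) s w).card ≤
      (outVerts D).card := by
    refine card_le_card_of_injOn Prod.fst ?_ ?_
    · rintro ⟨p, q⟩ hpq
      have hD := (mem_goodArcs.1 (mem_sdiff.1 hpq).1).1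
      simp only [outVerts, coe_filter, mem_univ, true_and, Set.mem_ofPred_eq]
      exact card_ne_zero_of_mem (a := q) (by simpa [outNbr] using hD)
    · rintro ⟨p, q⟩ hpq ⟨p', q'⟩ hpq' (rfl : p = p')
      rw [mem_coe, mem_sdiff] at hpq hpq'
      rcases lt_trichotomy (cycDist n e p q) (cycDist n e p q') with hlt | heq | hlt
      · exact (hpq'.2 (mem_goodArcs_insert_head hT he hs hw hsw huniq hpq.1
          (mem_goodArcs.1 hpq'.1).1 hlt)).elim
      · rw [cycDist_right_injective he hinj p heq]
      · exact (hpq.2 (mem_goodArcs_insert_head hT he hs hw hsw huniq hpq'.1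
          (mem_goodArcs.1 hpq.1).1 hlt)).elim
  have := card_le_card_sdiff_add_card (s := goodArcs D n e T S s t)
    (t := goodArcs D n e T (insert w S) s w)
  omega

theorem card_goodArcs_le_insert_tail (hT : Antidirected T) (he : ∀ x, e x < n)
    (hinj : Function.Injective e) {w : W} (ht : t ∈ S)
    (hw : w ∉ S) (hwt : T w t) (huniq : ∀ x ∈ S, T w x → x = t) :
    (goodArcs D n e T S s t).card ≤
      (goodArcs D n e T (insert w S) w t).card + (inVerts D).card := by
  classical
  have h : (goodArcs D n e T S s t \ goodArcs D n e T (insert w S) w t).card ≤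
      (inVerts D).card := by
    refine card_le_card_of_injOn Prod.snd ?_ ?_
    · rintro ⟨p, q⟩ hpq
      have hD := (mem_goodArcs.1 (mem_sdiff.1 hpq).1).1
      simp only [inVerts, coe_filter, mem_univ, true_and, Set.mem_ofPred_eq]
      exact card_ne_zero_of_mem (a := p) (by simpa [inNbr] using hD)
    · rintro ⟨p, q⟩ hpq ⟨p', q'⟩ hpq' (rfl : q = q')
      rw [mem_coe, mem_sdiff] at hpq hpq'
      rcases lt_trichotomy (cycDist n e p q) (cycDist n e p' q) with hlt | heq | hlt
      · exact (hpq'.2 (mem_goodArcs_insert_tail hT he ht hw hwt huniq hpq.1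
          (mem_goodArcs.1 hpq'.1).1 hlt)).elim
      · rw [cycDist_left_injective he hinj q heq]
      · exact (hpq.2 (mem_goodArcs_insert_tail hT he ht hw hwt huniq hpq'.1
          (mem_goodArcs.1 hpq.1).1 hlt)).elim
  have := card_le_card_sdiff_add_card (s := goodArcs D n e T S s t)
    (t := goodArcs D n e T (insert w S) w t)
  omega

theorem arcCount_le_card_goodArcs_pair (hT : Antidirected T) (hD : Loopless D) (hst : T s t) :
    arcCount D ≤ (goodArcs D n e T {s, t} s t).card := by
  refine card_le_card ?_
  rintro ⟨p, q⟩ hpq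
  replace hpq : D p q := by simpa using hpq
  have hpq' : p ≠ q := by
    rintro rfl
    exact hD p hpq
  have hne : s ≠ t := by
    rintro rfl
    exact hT _ _ _ hst hst
  refine mem_goodArcs.2 ⟨hpq, fun x => if x = s then p else q, ?_, ?_, by simp,
    by simp [hne.symm], ?_⟩
  · intro x hx y hy hxy
    simp only [coe_insert, coe_singleton, Set.mem_insert_iff, Set.mem_singleton_iff] at hx hy
    rcases hx with rfl | rfl <;> rcases hy with rfl | rfl <;>
      simp [hne.symm, hpq', hpq'.symm] at hxy ⊢
  · intro x hx y hy hxy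
    simp only [mem_insert, mem_singleton] at hx hy
    rcases hx with rfl | rfl
    · rcases hy with rfl | rfl
      · exact (hT _ _ _ hxy hxy).elim
      · simpa [hne.symm] using hpq
    · exact (hT _ _ _ hst hxy).elim
  · intro x hx
    simp only [mem_insert, mem_singleton] at hx
    rcases hx with rfl | rfl
    · simpa using inArc_left p q
    · simpa [hne.symm] using inArc_right p q

theorem Zigzag.arcCount_le (hT : Antidirected T) (hD : Loopless D) (he : ∀ x, e x < n)
    (hinj : Function.Injective e) (h : Zigzag T S s t i j) :
    arcCount D ≤ (goodArcs D n e T S s t).card + i * (outVerts D).card +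
      j * (inVerts D).card := by
  induction h with
  | single h => simpa using arcCount_le_card_goodArcs_pair hT hD h
  | @addHead S s t w i j h hw hsw huniq ih =>
    have := card_goodArcs_le_insert_head (D := D) (t := t) hT he hinj h.ends_mem.1 hw hsw huniq
    rw [add_one_mul]
    exact ih.trans (by omega)
  | @addTail S s t w i j h hw hwt huniq ih =>
    have := card_goodArcs_le_insert_tail (D := D) (s := s) hT he hinj h.ends_mem.2 hw hwt huniq
    rw [add_one_mul]
    exact ih.trans (by omega)

theorem Zigzag.exists_embedding (hT : Antidirected T) (hD : Loopless D)
    (h : Zigzag T S s t i j)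
    (harcs : i * (outVerts D).card + j * (inVerts D).card < arcCount D) :
    ∃ f : W → V, Set.InjOn f S ∧ ∀ x ∈ S, ∀ y ∈ S, T x y → D (f x) (f y) := by
  have hle := h.arcCount_le hT hD (n := Fintype.card V)
    (e := fun x => (Fintype.equivFin V x : ℕ)) (fun x => (Fintype.equivFin V x).isLt)
    (Fin.val_injective.comp (Fintype.equivFin V).injective)
  obtain ⟨⟨p, q⟩, hpq⟩ := card_pos.1 (Nat.pos_of_ne_zero fun h0 => by
    rw [h0] at hle
    omega : 0 < (goodArcs D (Fintype.card V) (fun x => (Fintype.equivFin V x : ℕ)) T S s t).card)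
  obtain ⟨-, f, hf, harc, -⟩ := mem_goodArcs.1 hpq
  exact ⟨f, hf, harc⟩

end Zigzag

section Broom

variable {W : Type*} {T : W → W → Bool}

theorem underG_adj_of_arc (hT : Antidirected T) {x y : W} (h : T x y) : (underG T).Adj x y := by
  refine (SimpleGraph.fromRel_adj _ _ _).2 ⟨?_, Or.inl h⟩
  rintro rfl
  exact hT _ _ _ h h

theorem arc_of_adj_of_arc_from (hT : Antidirected T) {x y z : W} (h : (underG T).Adj x y)
    (hx : T x z) : T x y := by
  rcases ((SimpleGraph.fromRel_adj _ _ _).1 h).2 with h | h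
  · exact h
  · exact (hT _ _ _ h hx).elim

theorem arc_of_adj_of_arc_to (hT : Antidirected T) {x y z : W} (h : (underG T).Adj x y)
    (hy : T z x) : T y x := by
  rcases ((SimpleGraph.fromRel_adj _ _ _).1 h).2 with h | h
  · exact (hT _ _ _ hy h).elim
  · exact h

variable {u v : W}

theorem arc_getVert (hT : Antidirected T) {z : W} (hu : T u z) (p : (underG T).Walk u v) (m : ℕ)
    (hm : m < p.length) :
    if Even m then T (p.getVert m) (p.getVert (m + 1)) else
      T (p.getVert (m + 1)) (p.getVert m) := by
  induction m with
  | zero =>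
    have := p.adj_getVert_succ hm
    rw [p.getVert_zero] at this
    simpa using arc_of_adj_of_arc_from hT this hu
  | succ m ih =>
    have h := ih (by omega)
    have hadj := p.adj_getVert_succ hm
    by_cases hm' : Even m
    · rw [if_pos hm'] at h
      rw [if_neg (by simpa [Nat.even_add_one] using hm')]
      exact arc_of_adj_of_arc_to hT hadj h
    · rw [if_neg hm'] at h
      rw [if_pos (by simpa [Nat.even_add_one] using hm')]
      exact arc_of_adj_of_arc_from hT hadj h

theorem odd_length (hT : Antidirected T) (huv : u ≠ v) {y z : W} (hu : T u z) (hv : T y v)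
    (p : (underG T).Walk u v) : Odd p.length := by
  have hpos : p.length ≠ 0 := fun h => huv (SimpleGraph.Walk.eq_of_length_eq_zero h)
  obtain ⟨m, hm⟩ := Nat.exists_eq_succ_of_ne_zero hpos
  have h := arc_getVert hT hu p m (by omega)
  rw [← Nat.succ_eq_add_one, ← hm, p.getVert_length] at h
  rw [hm, Nat.succ_eq_add_one]
  by_contra hodd
  rw [if_neg (by simpa [Nat.even_add_one] using hodd)] at h
  exact hT _ _ _ hv h

variable [Fintype W] [DecidableEq W]

/-- The out-neighbours of `u` together with the first `2 * r + 2` vertices of the walk `p`. -/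
def halfBroom (T : W → W → Bool) (p : (underG T).Walk u v) (r : ℕ) : Finset W :=
  insert u (outNbr T u) ∪ (range (2 * r + 2)).image p.getVert

theorem dist_le_of_mem_halfBroom (hT : Antidirected T) (htree : (underG T).IsTree)
    {p : (underG T).Walk u v} (hp : p.IsPath) {r : ℕ} (hr : 2 * r + 1 ≤ p.length) {x : W}
    (hx : x ∈ halfBroom T p r) : (underG T).dist u x ≤ 2 * r + 1 := by
  simp only [halfBroom, mem_union, mem_insert, mem_image, mem_range] at hx
  rcases hx with (rfl | hx) | ⟨m, hm, rfl⟩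
  · simp
  · have hux : T u x := by simpa [outNbr] using hx
    rw [SimpleGraph.dist_eq_one_iff_adj.2 (underG_adj_of_arc hT hux)]
    omega
  · rw [htree.dist_getVert hp (by omega)]
    omega

theorem zigzag_halfBroom_zero (hT : Antidirected T) (huv : u ≠ v) (hu : 2 ≤ (outNbr T u).card)
    (p : (underG T).Walk u v) :
    Zigzag T (halfBroom T p 0) (p.getVert 0) (p.getVert 1) ((outNbr T u).card - 1) 0 := by
  have hpos : p.length ≠ 0 := fun h => huv (SimpleGraph.Walk.eq_of_length_eq_zero h)
  have hN : ∀ w, w ∈ outNbr T u ↔ T u w := fun w => by simp [outNbr]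
  obtain ⟨l, hl, hlx⟩ := exists_mem_ne (by omega : 1 < (outNbr T u).card) (p.getVert 1)
  have hux : T u (p.getVert 1) := by
    simpa using arc_getVert hT ((hN l).1 hl) p 0 (by omega)
  set x := p.getVert 1
  have hnot : ∀ w ∈ outNbr T u, w ≠ u := fun w hw h => by
    subst h
    exact hT _ _ _ ((hN _).1 hw) ((hN _).1 hw)
  have hbase := Zigzag.single (T := T) ((hN l).1 hl)
  have hsrc : ∀ w, T u w → ∀ y ∈ ({u, l} : Finset W), T y w → y = u := by
    intro w hw y hy hyw
    rcases mem_insert.1 hy with h | h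
    · exact h
    · rw [mem_singleton] at h
      subst h
      exact (hT _ _ _ ((hN y).1 hl) hyw).elim
  obtain ⟨t', ht'⟩ := hbase.addHeads hT (L := ((outNbr T u).erase l).erase x) (by
      rw [disjoint_right]
      intro w hw hw'
      simp only [mem_erase] at hw'
      rcases mem_insert.1 hw with h | h
      · exact hnot w hw'.2.2 h
      · exact hw'.2.1 (mem_singleton.1 h))
    fun w hw => by
      have hw' : T u w := (hN w).1 (mem_of_mem_erase (mem_of_mem_erase hw))
      exact ⟨hw', hsrc w hw'⟩
  have hfin := ht'.addHead (w := x) (by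
      simp [hlx.symm, hnot x ((hN x).2 hux)]) hux (by
      intro y hy hyx
      rcases mem_union.1 hy with h | h
      · exact (hT _ _ _ ((hN y).1 (mem_of_mem_erase (mem_of_mem_erase h))) hyx).elim
      · exact hsrc x hux y h hyx)
  have hxl : x ∈ (outNbr T u).erase l := mem_erase.2 ⟨hlx.symm, (hN x).2 hux⟩
  rw [card_erase_of_mem hxl, card_erase_of_mem hl] at hfin
  have hS : insert x (((outNbr T u).erase l).erase x ∪ {u, l}) = halfBroom T p 0 := by
    ext y
    have hr : range (2 * 0 + 2) = {0, 1} := rfl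
    simp only [halfBroom, hr, image_insert, image_singleton, p.getVert_zero, mem_insert, mem_union,
      mem_erase, mem_singleton]
    change y = x ∨ (y ≠ x ∧ y ≠ l ∧ y ∈ outNbr T u) ∨ y = u ∨ y = l ↔
      (y = u ∨ y ∈ outNbr T u) ∨ y = u ∨ y = x
    constructor
    · rintro (h | h | h | rfl) <;> tauto
    · tauto
  rw [hS] at hfin
  rw [p.getVert_zero]
  convert hfin using 1
  omega

theorem zigzag_halfBroom (hT : Antidirected T) (htree : (underG T).IsTree) (huv : u ≠ v)
    (hu : 2 ≤ (outNbr T u).card) {p : (underG T).Walk u v} (hp : p.IsPath) (r : ℕ)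
    (hr : 2 * r + 1 ≤ p.length) :
    Zigzag T (halfBroom T p r) (p.getVert (2 * r)) (p.getVert (2 * r + 1))
      ((outNbr T u).card - 1 + r) r := by
  induction r with
  | zero => exact zigzag_halfBroom_zero hT huv hu p
  | succ r ih =>
    have hz := ih (by omega)
    obtain ⟨z, hz'⟩ := card_pos.1 (by omega : 0 < (outNbr T u).card)
    have huz : T u z := by simpa [outNbr] using hz'
    have ha1 := arc_getVert hT huz p (2 * r + 1) (by omega)
    have ha2 := arc_getVert hT huz p (2 * r + 2) (by omega)
    rw [if_neg (by simp)] at ha1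
    rw [if_pos (by simp [Nat.even_add])] at ha2
    change T (p.getVert (2 * r + 2)) (p.getVert (2 * r + 1)) at ha1
    change T (p.getVert (2 * r + 2)) (p.getVert (2 * r + 3)) at ha2
    have hd : ∀ m, m ≤ 2 * r + 3 → (underG T).dist u (p.getVert m) = m := fun m hm =>
      htree.dist_getVert hp (by omega)
    have hd1 := hd (2 * r + 1) (by omega)
    have hd2 := hd (2 * r + 2) (by omega)
    have hd3 := hd (2 * r + 3) (by omega)
    have hle := fun x (hx : x ∈ halfBroom T p r) =>
      dist_le_of_mem_halfBroom hT htree hp (by omega) hx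
    have hz1 := hz.addTail (w := p.getVert (2 * r + 2)) (fun h => by
        have := hle _ h
        omega) ha1 fun x hx hxw =>
      htree.eq_of_adj_of_dist_le (r := u) (underG_adj_of_arc hT ha1).symm (by omega)
        (underG_adj_of_arc hT hxw).symm (by have := hle x hx; omega)
    have hz2 := hz1.addHead (w := p.getVert (2 * r + 3)) (fun h => by
        rcases mem_insert.1 h with h | h
        · rw [h] at hd3
          omega
        · have := hle _ h
          omega) ha2 fun x hx hxw =>
      htree.eq_of_adj_of_dist_le (r := u) (underG_adj_of_arc hT ha2) (by omega)
        (underG_adj_of_arc hT hxw) (by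
          rcases mem_insert.1 hx with rfl | hx
          · omega
          · have := hle x hx
            omega)
    have hS : insert (p.getVert (2 * r + 3)) (insert (p.getVert (2 * r + 2)) (halfBroom T p r)) =
        halfBroom T p (r + 1) := by
      simp only [halfBroom, show 2 * (r + 1) + 2 = 2 * r + 2 + 1 + 1 by ring, range_add_one,
        image_insert, union_insert]
    rw [hS] at hz2
    exact hz2

/-- A double broom is built from an arc at `u` by adding the other out-neighbours of `u`, then the
path, then the other in-neighbours of `v`. -/
theorem exists_zigzag_broomSet (hT : Antidirected T) (htree : (underG T).IsTree) (huv : u ≠ v)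
    (hu : 2 ≤ (outNbr T u).card) (hv : 1 ≤ (inNbr T v).card) {p : (underG T).Walk u v}
    (hp : p.IsPath) :
    ∃ s r, Zigzag T (broomSet T p) s v ((outNbr T u).card - 1 + r)
      (r + ((inNbr T v).card - 1)) := by
  obtain ⟨z, hz⟩ := card_pos.1 (by omega : 0 < (outNbr T u).card)
  obtain ⟨y, hy⟩ := card_pos.1 (by omega : 0 < (inNbr T v).card)
  have huz : T u z := by simpa [outNbr] using hz
  have hyv : T y v := by simpa [inNbr] using hy
  have hN : ∀ w, w ∈ inNbr T v ↔ T w v := fun w => by simp [inNbr]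
  obtain ⟨r, hr⟩ := odd_length hT huv huz hyv p
  have hzz := zigzag_halfBroom hT htree huv hu hp r hr.ge
  have hlast := arc_getVert hT huz p (2 * r) (by omega)
  have hd0 := htree.dist_getVert hp (m := 2 * r) (by omega)
  have hd1 := htree.dist_getVert hp (m := 2 * r + 1) (by omega)
  have hend : p.getVert (2 * r + 1) = v := by rw [← hr, p.getVert_length]
  rw [if_pos (by simp)] at hlast
  rw [hend] at hzz hlast hd1
  set x := p.getVert (2 * r)
  have hle := fun w (hw : w ∈ halfBroom T p r) =>
    dist_le_of_mem_halfBroom hT htree hp hr.ge hw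
  have hfar : ∀ w ∈ (inNbr T v).erase x, (underG T).dist u w = 2 * r + 2 := by
    intro w hw
    rw [mem_erase, hN] at hw
    have hadj := underG_adj_of_arc hT hw.2
    by_contra hne
    refine hw.1 (htree.eq_of_adj_of_dist_le (r := u) (underG_adj_of_arc hT hlast) (by omega)
      hadj ?_)
    rcases htree.dist_eq_dist_add_one_of_adj u hadj with h | h <;> omega
  obtain ⟨s, hs⟩ := hzz.addTails hT (L := (inNbr T v).erase x) (by
      rw [disjoint_left]
      intro w hw hw'
      have := hfar w hw
      have := hle w hw'
      omega)
    fun w hw => by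
      have hwv : T w v := (hN w).1 (mem_of_mem_erase hw)
      have := hfar w hw
      exact ⟨hwv, fun a ha hwa => htree.eq_of_adj_of_dist_le (r := u)
        (underG_adj_of_arc hT hwv).symm (by omega) (underG_adj_of_arc hT hwa).symm
        (by have := hle a ha; omega)⟩
  rw [card_erase_of_mem ((hN x).2 hlast)] at hs
  refine ⟨s, r, ?_⟩
  have hS : (inNbr T v).erase x ∪ halfBroom T p r = broomSet T p := by
    have hiu : inNbr T u = ∅ := by
      refine filter_eq_empty_iff.2 fun w _ hw => hT _ _ _ hw huz
    have hov : outNbr T v = ∅ := by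
      refine filter_eq_empty_iff.2 fun w _ hw => hT _ _ _ hyv hw
    have hsup : ∀ w, w ∈ p.support ↔ ∃ m < 2 * r + 2, p.getVert m = w := by
      intro w
      rw [SimpleGraph.Walk.mem_support_iff_exists_getVert]
      exact ⟨fun ⟨m, hm, hm'⟩ => ⟨m, by omega, hm⟩, fun ⟨m, hm, hm'⟩ => ⟨m, hm', by omega⟩⟩
    have hus := p.start_mem_support
    have hxs : x ∈ p.support := p.getVert_mem_support _
    ext w
    simp only [broomSet, halfBroom, hiu, hov, union_empty, empty_union, mem_union, mem_erase,
      mem_insert, mem_image, mem_range, List.mem_toFinset, ← hsup]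
    by_cases hwx : w = x
    · rw [hwx]
      tauto
    · by_cases hwu : w = u
      · rw [hwu]
        tauto
      · tauto
  rwa [hS] at hs

end Broom

theorem secondMaxDeg_le_maxDeg {V : Type*} [Fintype V] (A : V → V → Bool) :
    secondMaxDeg A ≤ maxDeg A := by
  refine Multiset.sup_le.2 fun b hb => ?_
  obtain ⟨a, ha, rfl⟩ := Multiset.mem_map.1 (Multiset.mem_of_mem_erase hb)
  exact le_sup (f := totalDeg A) ha

/-- (Subcase (II) of Case A of Lemma `lemma:thirdpart2`.) If `u` is an
out-vertex with `deg⁺(u) = Δ(T)`, `v` is an in-vertex with `deg⁻(v) = Δ₂(T) ≥ ⌊k/4⌋ + 3`,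
`Δ(T) + Δ₂(T) < 7k/12` and `|B_uv(T)| ≤ k + 1 − (Δ(T) − Δ₂(T))`, then `B_uv(T)` embeds in
every digraph `D'` with `a(D') > (k−1)(|(D')⁺| + |(D')⁻|)/2`. -/
theorem stmt_19 (k : ℕ) (hk : 0 < k)
    {W : Type*} [Fintype W] [DecidableEq W]
    (T : W → W → Bool) (hT : Antidirected T)
    (htree : (underG T).IsTree) (hkT : arcCount T = k)
    (u v : W) (huv : u ≠ v)
    (hu : (outNbr T u).card = maxDeg T)
    (hv : (inNbr T v).card = secondMaxDeg T)
    (hD2 : k / 4 + 3 ≤ secondMaxDeg T)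
    (hsum : 12 * (maxDeg T + secondMaxDeg T) < 7 * k)
    (p : (underG T).Walk u v) (hp : p.IsPath)
    (hsize : (broomSet T p).card + (maxDeg T - secondMaxDeg T) ≤ k + 1)
    {V : Type*} [Fintype V] [DecidableEq V]
    (D' : V → V → Bool) (hloop : Loopless D')
    (harcs : (k - 1) * ((outVerts D').card + (inVerts D').card) < 2 * arcCount D') :
    ∃ f : W → V, Set.InjOn f ↑(broomSet T p) ∧
      ∀ x ∈ broomSet T p, ∀ y ∈ broomSet T p, T x y → D' (f x) (f y) := by
  have hle := secondMaxDeg_le_maxDeg T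
  obtain ⟨s, r, hz⟩ := exists_zigzag_broomSet hT htree huv (by omega) (by omega) hp
  have hcard := hz.card_eq hT
  rw [hu, hv] at hz hcard
  refine hz.exists_embedding hT hloop ?_
  have h1 := Nat.mul_le_mul_right (outVerts D').card
    (by omega : 2 * (maxDeg T - 1 + r) ≤ k - 1)
  have h2 := Nat.mul_le_mul_right (inVerts D').card
    (by omega : 2 * (r + (secondMaxDeg T - 1)) ≤ k - 1)
  nlinarith
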